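/- arXiv:1004.0432 — 2 statements merged into one kernel-verified Lean document; each statement's English description precedes it below -/
import Mathlib

section
/- (Polarization of the out-focus) Let f, g : Fin n → ℝ with ∑ᵢ fᵢ = 1, ∑ᵢ gᵢ = 1, fᵢ > 0 and gᵢ ≥ 0 for all i, and suppose D_{fg} := ‖x̄_f − x̄_g‖² > 0. Set b := Δ_f − Δ_g − D_{fg} and ε₊ := (b + √(b² + 4 Δ_f D_{fg}))/(2 D_{fg}). Then 0 < ε₊ ≤ Δ_f / D_{fg}, with equality ε₊ = Δ_f / D_{fg} if and only if Δ_g = 0. -/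
open Finset

noncomputable def centroid {E : Type*} [NormedAddCommGroup E] [InnerProductSpace ℝ E]
    {n : ℕ} (x : Fin n → E) (w : Fin n → ℝ) : E :=
  ∑ i, w i • x i

noncomputable def inertiaAt {E : Type*} [NormedAddCommGroup E] [InnerProductSpace ℝ E]
    {n : ℕ} (x : Fin n → E) (w : Fin n → ℝ) (a : E) : ℝ :=
  ∑ i, w i * ‖x i - a‖ ^ 2

noncomputable def inertia {E : Type*} [NormedAddCommGroup E] [InnerProductSpace ℝ E]
    {n : ℕ} (x : Fin n → E) (w : Fin n → ℝ) : ℝ :=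
  inertiaAt x w (centroid x w)

noncomputable def relDisp {E : Type*} [NormedAddCommGroup E] [InnerProductSpace ℝ E]
    {n : ℕ} (x : Fin n → E) (g f : Fin n → ℝ) (a : E) : ℝ :=
  inertiaAt x g a / inertiaAt x f a

theorem inertia_nonneg {E : Type*} [NormedAddCommGroup E] [InnerProductSpace ℝ E]
    {n : ℕ} (x : Fin n → E) (w : Fin n → ℝ) (hw : ∀ i, 0 ≤ w i) : 0 ≤ inertia x w := by
  unfold inertia inertiaAt
  exact Finset.sum_nonneg fun i _ => mul_nonneg (hw i) (sq_nonneg _)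

/-- If all weights are positive and the inertia vanishes, every point is the centroid. -/
theorem eq_centroid_of_inertia_eq_zero {E : Type*} [NormedAddCommGroup E]
    [InnerProductSpace ℝ E] {n : ℕ} (x : Fin n → E) (w : Fin n → ℝ) (hw : ∀ i, 0 < w i)
    (h : inertia x w = 0) (i : Fin n) : x i = centroid x w := by
  unfold inertia inertiaAt at h
  have hi := (Finset.sum_eq_zero_iff_of_nonneg
    fun j _ => mul_nonneg (hw j).le (sq_nonneg ‖x j - centroid x w‖)).1 h i (Finset.mem_univ i)
  simpa [(hw i).ne', sub_eq_zero] using hi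

/-- Two centroids can only differ if the inertia for positive weights is positive. -/
theorem inertia_pos_of_centroid_ne {E : Type*} [NormedAddCommGroup E]
    [InnerProductSpace ℝ E] {n : ℕ} (x : Fin n → E) (f g : Fin n → ℝ)
    (hg : ∑ i, g i = 1) (hf : ∀ i, 0 < f i) (hne : centroid x f ≠ centroid x g) :
    0 < inertia x f := by
  refine (inertia_nonneg x f fun i => (hf i).le).lt_of_ne' fun h => hne ?_
  have hx := eq_centroid_of_inertia_eq_zero x f hf h
  calc centroid x f = (∑ i, g i) • centroid x f := by rw [hg, one_smul]
    _ = ∑ i, g i • centroid x f := Finset.sum_smul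
    _ = centroid x g := Finset.sum_congr rfl fun i _ => by rw [← hx i]

/-- Bounds on the positive root of `D ε² - (A - G - D) ε - A = 0`. -/
theorem pos_root_bounds {A G D : ℝ} (hA : 0 < A) (hG : 0 ≤ G) (hD : 0 < D) :
    0 < ((A - G - D) + √((A - G - D) ^ 2 + 4 * A * D)) / (2 * D) ∧
    ((A - G - D) + √((A - G - D) ^ 2 + 4 * A * D)) / (2 * D) ≤ A / D ∧
    (((A - G - D) + √((A - G - D) ^ 2 + 4 * A * D)) / (2 * D) = A / D ↔ G = 0) := by
  have hAD : 0 < A * D := mul_pos hA hD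
  have hAG : 0 ≤ A * G := mul_nonneg hA.le hG
  have hgap : (A - G - D) ^ 2 + 4 * A * D = (A + G + D) ^ 2 - 4 * (A * G) := by ring
  have hdouble : A / D = 2 * A / (2 * D) := (mul_div_mul_left A D two_ne_zero).symm
  refine ⟨div_pos ?_ (by positivity), ?_, ?_⟩
  · have h : -(A - G - D) < √((A - G - D) ^ 2 + 4 * A * D) :=
      Real.lt_sqrt_of_sq_lt (by nlinarith)
    linarith
  · have h : √((A - G - D) ^ 2 + 4 * A * D) ≤ A + G + D :=
      Real.sqrt_le_iff.2 ⟨by positivity, by linarith⟩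
    rw [hdouble]
    gcongr
    linarith
  · have h : √((A - G - D) ^ 2 + 4 * A * D) = A + G + D ↔ G = 0 := by
      rw [Real.sqrt_eq_iff_eq_sq (by positivity) (by positivity), hgap, sub_eq_self]
      simp [hA.ne']
    rw [hdouble, div_left_inj' (by positivity), ← h]
    constructor <;> intro h' <;> linarith

/-- Polarization of the out-focus: the out-focus parameter
`ε₊ = (b + √(b² + 4 Δ_f D_{fg}))/(2 D_{fg})` satisfies `0 < ε₊ ≤ Δ_f / D_{fg}`, with
equality on the right iff the group is dispersion-free (`Δ_g = 0`). -/
theorem outFocus_polarization {E : Type*} [NormedAddCommGroup E] [InnerProductSpace ℝ E]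
    {n : ℕ} (x : Fin n → E) (f g : Fin n → ℝ)
    (hf : ∑ i, f i = 1) (hg : ∑ i, g i = 1)
    (hfpos : ∀ i, 0 < f i) (hgnonneg : ∀ i, 0 ≤ g i)
    (hD : 0 < ‖centroid x f - centroid x g‖ ^ 2) :
    (0 < ((inertia x f - inertia x g - ‖centroid x f - centroid x g‖ ^ 2) +
        Real.sqrt ((inertia x f - inertia x g - ‖centroid x f - centroid x g‖ ^ 2) ^ 2 +
          4 * inertia x f * ‖centroid x f - centroid x g‖ ^ 2)) /
      (2 * ‖centroid x f - centroid x g‖ ^ 2)) ∧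
    (((inertia x f - inertia x g - ‖centroid x f - centroid x g‖ ^ 2) +
        Real.sqrt ((inertia x f - inertia x g - ‖centroid x f - centroid x g‖ ^ 2) ^ 2 +
          4 * inertia x f * ‖centroid x f - centroid x g‖ ^ 2)) /
      (2 * ‖centroid x f - centroid x g‖ ^ 2) ≤
        inertia x f / ‖centroid x f - centroid x g‖ ^ 2) ∧
    (((inertia x f - inertia x g - ‖centroid x f - centroid x g‖ ^ 2) +
        Real.sqrt ((inertia x f - inertia x g - ‖centroid x f - centroid x g‖ ^ 2) ^ 2 +
          4 * inertia x f * ‖centroid x f - centroid x g‖ ^ 2)) /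
      (2 * ‖centroid x f - centroid x g‖ ^ 2) =
        inertia x f / ‖centroid x f - centroid x g‖ ^ 2 ↔ inertia x g = 0) := by
  refine pos_root_bounds (inertia_pos_of_centroid_ne x f g hg hfpos fun h => ?_)
    (inertia_nonneg x g hgnonneg) hD
  simp [h] at hD
end

section
/- Let x : Fin n → E be points of a real inner product space E and let f, g : Fin n → ℝ satisfy ∑ᵢ fᵢ = 1 and ∑ᵢ gᵢ = 1. Then b_{fg} := Δ_f − Δ_g − D_{fg} = ∑ᵢ ∑ⱼ fᵢ (fⱼ − gⱼ) ‖xᵢ − xⱼ‖², where Δ_w := ∑ᵢ wᵢ‖xᵢ − x̄_w‖² and D_{fg} := ‖x̄_f − x̄_g‖². -/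
open Finset

/-- Huygens–Steiner (parallel axis) theorem. -/
theorem inertiaAt_eq_inertia_add {E : Type*} [NormedAddCommGroup E] [InnerProductSpace ℝ E]
    {n : ℕ} (x : Fin n → E) (w : Fin n → ℝ) (hw : ∑ i, w i = 1) (a : E) :
    inertiaAt x w a = inertia x w + ‖centroid x w - a‖ ^ 2 := by
  set c := centroid x w with hc
  have hcross : ∑ i, w i * inner ℝ (x i - c) (c - a) = 0 := by
    simp_rw [← real_inner_smul_left, ← sum_inner, smul_sub, sum_sub_distrib, ← sum_smul, hw]
    simp [hc, _root_.centroid]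
  have hterm (i : Fin n) : w i * ‖x i - a‖ ^ 2 = w i * ‖x i - c‖ ^ 2 +
      2 * (w i * inner ℝ (x i - c) (c - a)) + w i * ‖c - a‖ ^ 2 := by
    rw [← sub_add_sub_cancel (x i) c a, norm_add_sq_real]
    ring
  simp_rw [inertia, inertiaAt, hterm, sum_add_distrib, ← mul_sum, ← sum_mul, hcross, hw]
  ring

/-- Distance-based identity for `b_{fg} = Δ_f − Δ_g − D_{fg}`:
`b_{fg} = ∑ᵢ∑ⱼ fᵢ (fⱼ − gⱼ) ‖xᵢ − xⱼ‖²`. -/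
theorem b_fg_eq {E : Type*} [NormedAddCommGroup E] [InnerProductSpace ℝ E]
    {n : ℕ} (x : Fin n → E) (f g : Fin n → ℝ)
    (hf : ∑ i, f i = 1) (hg : ∑ i, g i = 1) :
    inertia x f - inertia x g - ‖centroid x f - centroid x g‖ ^ 2 =
      ∑ i, ∑ j, f i * (f j - g j) * ‖x i - x j‖ ^ 2 := by
  have hrow (i : Fin n) : ∑ j, f i * (f j - g j) * ‖x i - x j‖ ^ 2 =
      f i * (inertia x f - inertia x g) +
        (f i * ‖x i - centroid x f‖ ^ 2 - f i * ‖x i - centroid x g‖ ^ 2) := by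
    have hf' := inertiaAt_eq_inertia_add x f hf (x i)
    have hg' := inertiaAt_eq_inertia_add x g hg (x i)
    simp_rw [norm_sub_rev (x i), mul_assoc, ← mul_sum, sub_mul, sum_sub_distrib]
    rw [inertiaAt] at hf' hg'
    rw [hf', hg']
    ring
  have hΔ : ∑ i, f i * ‖x i - centroid x f‖ ^ 2 = inertia x f := rfl
  have hD := inertiaAt_eq_inertia_add x f hf (centroid x g)
  rw [inertiaAt] at hD
  simp_rw [hrow, sum_add_distrib, sum_sub_distrib, ← sum_mul, hf, hΔ, hD]
  ring
end
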